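/- arXiv:2401.02917 — 2 statements merged into one kernel-verified Lean document; each statement's English description precedes it below -/
import Mathlib

section
/- Geometric decay of the posterior away from the true changepoint: suppose γ > 0, κ* ∈ {1, ..., n−1}, a_i < −γ for all i ≤ κ*, and a_i > γ for all i > κ*. Then for every κ ∈ {1, ..., n−1} with κ ≠ κ*, one has π(κ) < e^{−|κ − κ*|·γ} · π(κ*). -/
open Real Finset

/-- The logistic (inverse logit) function `F(t) = eᵗ / (1 + eᵗ)`. -/
noncomputable def F (t : ℝ) : ℝ := Real.exp t / (1 + Real.exp t)

/-- The quasi-likelihood `Q(κ) = ∏_{i=1}^{κ} (1 − F(a_i)) · ∏_{i=κ+1}^{n} F(a_i)`. -/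
noncomputable def Q (n : ℕ) (a : ℕ → ℝ) (κ : ℕ) : ℝ :=
  (∏ i ∈ Finset.Icc 1 κ, (1 - F (a i))) * ∏ i ∈ Finset.Icc (κ + 1) n, F (a i)

/-- The posterior probability mass function `π(κ) = Q(κ) / ∑_{k=1}^{n−1} Q(k)`. -/
noncomputable def post (n : ℕ) (a : ℕ → ℝ) (κ : ℕ) : ℝ :=
  Q n a κ / ∑ k ∈ Finset.Icc 1 (n - 1), Q n a k

lemma F_pos (t : ℝ) : 0 < F t := by
  unfold F; positivity

lemma one_sub_F (t : ℝ) : 1 - F t = Real.exp (-t) * F t := by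
  have h : 1 + Real.exp t ≠ 0 := by positivity
  rw [F, Real.exp_neg]
  field_simp
  ring

lemma Q_pos (n : ℕ) (a : ℕ → ℝ) (k : ℕ) : 0 < Q n a k := by
  refine mul_pos (Finset.prod_pos fun i _ => ?_) (Finset.prod_pos fun i _ => F_pos _)
  rw [one_sub_F]
  exact mul_pos (Real.exp_pos _) (F_pos _)

/-- Moving the changepoint one step to the right multiplies `Q` by `e^{-a_{k+1}}`. -/
lemma Q_succ {n k : ℕ} (a : ℕ → ℝ) (hk : k + 1 ≤ n) :
    Q n a (k + 1) = Real.exp (-a (k + 1)) * Q n a k := by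
  rw [Q, Q, Finset.prod_Icc_succ_top (by omega), one_sub_F,
    ← Finset.mul_prod_Ioc_eq_prod_Icc hk, ← Finset.Icc_succ_left_eq_Ioc, Nat.succ_eq_succ]
  ring

/-- A sequence that shrinks by more than a factor `e^{-γ}` at each of `d + 1` steps shrinks by more
than `e^{-(d + 1)γ}` in total. -/
lemma lt_exp_neg_mul_of_step {f : ℕ → ℝ} {γ : ℝ} (d : ℕ)
    (h : ∀ j ≤ d, f (j + 1) < Real.exp (-γ) * f j) :
    f (d + 1) < Real.exp (-((d + 1 : ℕ) * γ)) * f 0 := by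
  induction d with
  | zero => simpa using h 0 le_rfl
  | succ d ih =>
    calc f (d + 1 + 1) < Real.exp (-γ) * f (d + 1) := h _ le_rfl
      _ < Real.exp (-γ) * (Real.exp (-((d + 1 : ℕ) * γ)) * f 0) := by
        gcongr
        exact ih fun j hj => h j (by omega)
      _ = Real.exp (-((d + 1 + 1 : ℕ) * γ)) * f 0 := by
        rw [← mul_assoc, ← Real.exp_add]
        push_cast
        ring_nf

/-- Geometric decay of the posterior away from the true changepoint: under the separation
hypothesis, `π(κ) < e^{−|κ − κ*|·γ} · π(κ*)` for every `κ ∈ {1, …, n−1}` with `κ ≠ κ*`. -/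
theorem posterior_geometric_decay (n : ℕ) (hn : 2 ≤ n) (a : ℕ → ℝ) (γ : ℝ) (hγ : 0 < γ)
    (κstar : ℕ) (hκs1 : 1 ≤ κstar) (hκs2 : κstar ≤ n - 1)
    (hpre : ∀ i, 1 ≤ i → i ≤ κstar → a i < -γ)
    (hpost : ∀ i, κstar < i → i ≤ n → γ < a i) :
    ∀ κ, 1 ≤ κ → κ ≤ n - 1 → κ ≠ κstar →
      post n a κ < Real.exp (-(|(κ : ℝ) - (κstar : ℝ)| * γ)) * post n a κstar := by
  intro κ h1 h2 hne
  have hsum : 0 < ∑ k ∈ Finset.Icc 1 (n - 1), Q n a k :=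
    Finset.sum_pos (fun k _ => Q_pos n a k) ⟨κ, Finset.mem_Icc.mpr ⟨h1, h2⟩⟩
  rw [post, post, ← mul_div_assoc]
  refine div_lt_div_of_pos_right ?_ hsum
  rcases lt_or_gt_of_ne hne with hlt | hgt
  · obtain ⟨d, rfl⟩ := Nat.exists_eq_add_of_lt hlt
    have key := lt_exp_neg_mul_of_step (f := fun j => Q n a (κ + d + 1 - j)) (γ := γ) d
      fun j hj => by
        obtain ⟨m, hm⟩ : ∃ m, κ + d + 1 - j = m + 1 := ⟨κ + d - j, by omega⟩
        have hm' : κ + d + 1 - (j + 1) = m := by omega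
        simp only [hm, hm']
        rw [Q_succ a (by omega), ← mul_assoc, ← Real.exp_add]
        refine lt_mul_of_one_lt_left (Q_pos n a m) (Real.one_lt_exp_iff.mpr ?_)
        linarith [hpre (m + 1) (by omega) (by omega)]
    have habs : |(κ : ℝ) - ((κ + d + 1 : ℕ) : ℝ)| = ((d + 1 : ℕ) : ℝ) := by
      rw [abs_sub_comm, ← Nat.cast_sub (by omega), Nat.abs_cast]
      congr 1
      omega
    rw [habs]
    simpa only [show κ + d + 1 - (d + 1) = κ by omega, Nat.sub_zero] using key
  · obtain ⟨d, rfl⟩ := Nat.exists_eq_add_of_lt hgt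
    have key := lt_exp_neg_mul_of_step (f := fun j => Q n a (κstar + j)) (γ := γ) d
      fun j hj => by
        simp only [← add_assoc]
        rw [Q_succ a (by omega)]
        refine mul_lt_mul_of_pos_right (Real.exp_lt_exp.mpr ?_) (Q_pos n a _)
        linarith [hpost (κstar + j + 1) (by omega) (by omega)]
    have habs : |((κstar + d + 1 : ℕ) : ℝ) - (κstar : ℝ)| = ((d + 1 : ℕ) : ℝ) := by
      rw [← Nat.cast_sub (by omega), Nat.abs_cast]
      congr 1
      omega
    rw [habs]
    simpa only [add_zero, ← add_assoc] using key
end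

section
/- Quasi-likelihood maximization form of Proposition 1: suppose γ > 0, κ* ∈ {1, ..., n−1}, a_i < −γ for all i ≤ κ*, and a_i > γ for all i > κ*. Then the unnormalized quasi-likelihood Q attains its strict maximum over {1, ..., n−1} at κ*: for every κ ∈ {1, ..., n−1} with κ ≠ κ*, one has Q(κ) < Q(κ*). -/
open Real Finset

lemma one_sub_F_eq (t : ℝ) : 1 - F t = 1 / (1 + Real.exp t) := by
  have h : 1 + Real.exp t ≠ 0 := by positivity
  unfold F
  field_simp
  ring

lemma one_sub_F_pos (t : ℝ) : 0 < 1 - F t := by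
  rw [one_sub_F_eq]
  positivity

lemma F_lt_one_sub_F {t : ℝ} (ht : t < 0) : F t < 1 - F t := by
  rw [one_sub_F_eq, F]
  exact div_lt_div_of_pos_right (Real.exp_lt_one_iff.mpr ht) (by positivity)

lemma one_sub_F_lt_F {t : ℝ} (ht : 0 < t) : 1 - F t < F t := by
  rw [one_sub_F_eq, F]
  exact div_lt_div_of_pos_right (Real.one_lt_exp_iff.mpr ht) (by positivity)

/-- Consecutive values of `Q` differ only in the factor of index `κ + 1`. -/
lemma exists_common_factor_Q {n κ : ℕ} (a : ℕ → ℝ) (hκ : κ < n) :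
    ∃ P : ℝ, 0 < P ∧ Q n a κ = F (a (κ + 1)) * P ∧
      Q n a (κ + 1) = (1 - F (a (κ + 1))) * P := by
  refine ⟨(∏ i ∈ Finset.Icc 1 κ, (1 - F (a i))) * ∏ i ∈ Finset.Icc (κ + 1 + 1) n, F (a i),
    mul_pos (Finset.prod_pos fun i _ => one_sub_F_pos _) (Finset.prod_pos fun i _ => F_pos _),
    ?_, ?_⟩
  · have h : Finset.Icc (κ + 1) n = insert (κ + 1) (Finset.Icc (κ + 1 + 1) n) := by
      ext i
      simp only [Finset.mem_insert, Finset.mem_Icc]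
      omega
    rw [Q, h, Finset.prod_insert (by simp)]
    ring
  · rw [Q, Finset.prod_Icc_succ_top (by omega)]
    ring

lemma Q_lt_Q_succ {n κ : ℕ} {a : ℕ → ℝ} (hκ : κ < n) (ha : a (κ + 1) < 0) :
    Q n a κ < Q n a (κ + 1) := by
  obtain ⟨P, hP, h₁, h₂⟩ := exists_common_factor_Q a hκ
  rw [h₁, h₂]
  exact mul_lt_mul_of_pos_right (F_lt_one_sub_F ha) hP

lemma Q_succ_lt_Q {n κ : ℕ} {a : ℕ → ℝ} (hκ : κ < n) (ha : 0 < a (κ + 1)) :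
    Q n a (κ + 1) < Q n a κ := by
  obtain ⟨P, hP, h₁, h₂⟩ := exists_common_factor_Q a hκ
  rw [h₁, h₂]
  exact mul_lt_mul_of_pos_right (one_sub_F_lt_F ha) hP

lemma Q_lt_Q_of_neg {n k m : ℕ} {a : ℕ → ℝ} (hkm : k < m) (hm : m ≤ n)
    (ha : ∀ i, k < i → i ≤ m → a i < 0) : Q n a k < Q n a m := by
  induction m, hkm using Nat.le_induction with
  | base => exact Q_lt_Q_succ (by omega) (ha _ (by omega) le_rfl)
  | succ m hkm ih =>
    exact (ih (by omega) fun i h₁ h₂ => ha i h₁ (by omega)).trans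
      (Q_lt_Q_succ (by omega) (ha _ (by omega) le_rfl))

lemma Q_lt_Q_of_pos {n k m : ℕ} {a : ℕ → ℝ} (hkm : k < m) (hm : m ≤ n)
    (ha : ∀ i, k < i → i ≤ m → 0 < a i) : Q n a m < Q n a k := by
  induction m, hkm using Nat.le_induction with
  | base => exact Q_succ_lt_Q (by omega) (ha _ (by omega) le_rfl)
  | succ m hkm ih =>
    exact (Q_succ_lt_Q (by omega) (ha _ (by omega) le_rfl)).trans
      (ih (by omega) fun i h₁ h₂ => ha i h₁ (by omega))

/-- Quasi-likelihood maximization form of Proposition 1: under the separation hypothesis, the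
unnormalized quasi-likelihood `Q` attains its strict maximum over `{1, …, n−1}` at `κ*`. -/
theorem quasi_likelihood_argmax (n : ℕ) (hn : 2 ≤ n) (a : ℕ → ℝ) (γ : ℝ) (hγ : 0 < γ)
    (κstar : ℕ) (hκs1 : 1 ≤ κstar) (hκs2 : κstar ≤ n - 1)
    (hpre : ∀ i, 1 ≤ i → i ≤ κstar → a i < -γ)
    (hpost : ∀ i, κstar < i → i ≤ n → γ < a i) :
    ∀ κ, 1 ≤ κ → κ ≤ n - 1 → κ ≠ κstar → Q n a κ < Q n a κstar := by
  intro κ _ hκn hne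
  rcases lt_or_gt_of_ne hne with h | h
  · exact Q_lt_Q_of_neg h (by omega) fun i h₁ h₂ =>
      (hpre i (by omega) h₂).trans (neg_lt_zero.mpr hγ)
  · exact Q_lt_Q_of_pos h (by omega) fun i h₁ h₂ => hγ.trans (hpost i h₁ (by omega))
end
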